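/- arXiv:2503.04645 — 4 statements merged into one kernel-verified Lean document; each statement's English description precedes it below -/
import Mathlib

section
/- (Theorem 1, discriminant gain reduction) Let d ≥ 1, let μ₁, μ₂ ∈ ℝ^d, let Σ be a symmetric positive-definite real d×d matrix, and let σ² > 0. Then (σ² / trace(Σ + σ² I)) · D₀ ≤ D₀ − D(σ²) ≤ σ² · trace((Σ + σ² I)⁻¹) · D₀. -/
open Matrix

theorem aux_quad {d : ℕ} (U : Matrix (Fin d) (Fin d) ℝ) (f v : Fin d → ℝ) :
    v ⬝ᵥ (U * diagonal f * Uᵀ).mulVec v = ∑ i, f i * (Uᵀ.mulVec v i) ^ 2 := by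
  rw [← mulVec_mulVec, ← mulVec_mulVec, dotProduct_mulVec, ← mulVec_transpose]
  simp only [dotProduct, mulVec_diagonal]
  exact Finset.sum_congr rfl fun i _ => by ring

theorem aux_trace {d : ℕ} (U : Matrix (Fin d) (Fin d) ℝ) (hU : Uᵀ * U = 1) (f : Fin d → ℝ) :
    (U * diagonal f * Uᵀ).trace = ∑ i, f i := by
  rw [trace_mul_comm, ← Matrix.mul_assoc, hU, Matrix.one_mul, trace_diagonal]

theorem aux_inv {d : ℕ} (U : Matrix (Fin d) (Fin d) ℝ) (hU : Uᵀ * U = 1) (hU' : U * Uᵀ = 1)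
    (f : Fin d → ℝ) (hf : ∀ i, 0 < f i) :
    (U * diagonal f * Uᵀ)⁻¹ = U * diagonal (fun i => (f i)⁻¹) * Uᵀ := by
  apply inv_eq_right_inv
  calc _ = U * diagonal f * (Uᵀ * U) * diagonal (fun i => (f i)⁻¹) * Uᵀ := by
        simp only [Matrix.mul_assoc]
    _ = U * (diagonal f * diagonal (fun i => (f i)⁻¹)) * Uᵀ := by
        rw [hU, Matrix.mul_one]; simp only [Matrix.mul_assoc]
    _ = 1 := by
        rw [diagonal_mul_diagonal]
        have : (fun i => f i * (f i)⁻¹) = fun _ => (1 : ℝ) :=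
          funext fun i => mul_inv_cancel₀ (hf i).ne'
        rw [this, diagonal_one, Matrix.mul_one, hU']

theorem aux_diag {d : ℕ} (S : Matrix (Fin d) (Fin d) ℝ) (hsymm : S.IsSymm)
    (hpd : ∀ x : Fin d → ℝ, x ≠ 0 → 0 < x ⬝ᵥ S.mulVec x) :
    ∃ (U : Matrix (Fin d) (Fin d) ℝ) (l : Fin d → ℝ), Uᵀ * U = 1 ∧ U * Uᵀ = 1 ∧ (∀ i, 0 < l i) ∧
      S = U * diagonal l * Uᵀ := by
  have hH : S.IsHermitian := by
    rw [Matrix.IsHermitian, conjTranspose_eq_transpose_of_trivial]; exact hsymm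
  have hP : S.PosDef := by
    refine Matrix.PosDef.of_dotProduct_mulVec_pos hH fun x hx => ?_
    simpa using hpd x hx
  have h1 := Unitary.coe_star_mul_self hH.eigenvectorUnitary
  have h2 := Unitary.coe_mul_star_self hH.eigenvectorUnitary
  rw [Unitary.coe_star] at h2
  have h3 := hH.spectral_theorem
  rw [Unitary.conjStarAlgAut_apply] at h3
  rw [star_eq_conjTranspose, conjTranspose_eq_transpose_of_trivial] at h1 h2 h3
  exact ⟨_, _, h1, h2, hP.eigenvalues_pos, h3⟩


/-- **Theorem 1, discriminant gain reduction.** For `d ≥ 1`, `μ₁ μ₂ ∈ ℝ^d`,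
a symmetric positive-definite `Σ`, and `σ² > 0`,
`(σ² / trace(Σ + σ² I)) ⬝ D₀ ≤ D₀ - D(σ²) ≤ σ² ⬝ trace((Σ + σ² I)⁻¹) ⬝ D₀`, where
`D₀ = (1/2)(μ₁-μ₂)ᵀ Σ⁻¹ (μ₁-μ₂)` and `D(σ²) = (1/2)(μ₁-μ₂)ᵀ (Σ + σ² I)⁻¹ (μ₁-μ₂)`. -/
theorem discriminant_gain_reduction {d : ℕ} (hd : 1 ≤ d) (μ₁ μ₂ : Fin d → ℝ)
    (S : Matrix (Fin d) (Fin d) ℝ) (hsymm : S.IsSymm)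
    (hpd : ∀ x : Fin d → ℝ, x ≠ 0 → 0 < x ⬝ᵥ S.mulVec x)
    (σ2 : ℝ) (hσ2 : 0 < σ2) :
    (σ2 / (S + σ2 • (1 : Matrix (Fin d) (Fin d) ℝ)).trace) *
        ((1 / 2) * ((μ₁ - μ₂) ⬝ᵥ S⁻¹.mulVec (μ₁ - μ₂)))
      ≤ (1 / 2) * ((μ₁ - μ₂) ⬝ᵥ S⁻¹.mulVec (μ₁ - μ₂))
        - (1 / 2) * ((μ₁ - μ₂) ⬝ᵥ (S + σ2 • (1 : Matrix (Fin d) (Fin d) ℝ))⁻¹.mulVec (μ₁ - μ₂)) ∧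
    (1 / 2) * ((μ₁ - μ₂) ⬝ᵥ S⁻¹.mulVec (μ₁ - μ₂))
        - (1 / 2) * ((μ₁ - μ₂) ⬝ᵥ (S + σ2 • (1 : Matrix (Fin d) (Fin d) ℝ))⁻¹.mulVec (μ₁ - μ₂))
      ≤ σ2 * ((S + σ2 • (1 : Matrix (Fin d) (Fin d) ℝ))⁻¹).trace *
        ((1 / 2) * ((μ₁ - μ₂) ⬝ᵥ S⁻¹.mulVec (μ₁ - μ₂))) := by
  obtain ⟨U, l, hU, hU', hl, rfl⟩ := aux_diag S hsymm hpd
  have hadd : U * diagonal l * Uᵀ + σ2 • (1 : Matrix (Fin d) (Fin d) ℝ)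
      = U * diagonal (fun i => l i + σ2) * Uᵀ := by
    have h : diagonal (fun i => l i + σ2) = diagonal l + σ2 • (1 : Matrix (Fin d) (Fin d) ℝ) := by
      rw [← diagonal_one, ← diagonal_smul, diagonal_add]; simp
    rw [h, Matrix.mul_add, Matrix.add_mul]
    simp [hU']
  have hls : ∀ i, 0 < l i + σ2 := fun i => add_pos (hl i) hσ2
  rw [hadd, aux_inv U hU hU' _ hls, aux_inv U hU hU' _ hl, aux_trace U hU, aux_trace U hU,
    aux_quad, aux_quad, ← mul_sub, ← Finset.sum_sub_distrib, mul_left_comm, mul_left_comm (σ2 * _)]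
  set w := Uᵀ.mulVec (μ₁ - μ₂)
  have key : ∀ i, (l i)⁻¹ * w i ^ 2 - (l i + σ2)⁻¹ * w i ^ 2
      = (σ2 * (l i + σ2)⁻¹) * ((l i)⁻¹ * w i ^ 2) := fun i => by
    have := (hl i).ne'
    have := (hls i).ne'
    field_simp
    ring
  have hn : ∀ i, 0 ≤ (l i)⁻¹ * w i ^ 2 := fun i =>
    mul_nonneg (inv_nonneg.2 (hl i).le) (sq_nonneg _)
  constructor
  · refine mul_le_mul_of_nonneg_left ?_ (by norm_num : (0 : ℝ) ≤ 1 / 2)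
    rw [Finset.mul_sum]
    refine Finset.sum_le_sum fun i _ => ?_
    rw [key]
    refine mul_le_mul_of_nonneg_right ?_ (hn i)
    rw [div_eq_mul_inv]
    refine mul_le_mul_of_nonneg_left (inv_anti₀ (hls i) ?_) hσ2.le
    exact Finset.single_le_sum (f := fun i => l i + σ2) (fun j _ => (hls j).le) (Finset.mem_univ i)
  · refine mul_le_mul_of_nonneg_left ?_ (by norm_num : (0 : ℝ) ≤ 1 / 2)
    rw [Finset.mul_sum]
    refine Finset.sum_le_sum fun i _ => ?_
    rw [key]
    refine mul_le_mul_of_nonneg_right (mul_le_mul_of_nonneg_left ?_ hσ2.le) (hn i)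
    exact Finset.single_le_sum (f := fun i => (l i + σ2)⁻¹)
      (fun j _ => (inv_pos.2 (hls j)).le) (Finset.mem_univ i)
end

section
/- (Laplace-method ratio at the capacity-achieving SNR) Fix R_c > 0 and define, for γ > 0, C(γ) = log₂(1+γ), V(γ) = (γ(2+γ)/(1+γ)²)·(log₂ e)², and g(γ) = (C(γ) − R_c)² / (2 V(γ)). Let γ* = 2^{R_c} − 1. Then g'(γ)² / (2 g''(γ) g(γ)) tends to 1 as γ tends to γ* within (0,∞) \ {γ*}. -/
open Filter

/-- Shannon capacity `C(γ) = log₂(1 + γ)`. -/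
noncomputable def shannonC (γ : ℝ) : ℝ := Real.logb 2 (1 + γ)

/-- Channel dispersion `V(γ) = (γ(2+γ)/(1+γ)²) (log₂ e)²`. -/
noncomputable def dispersionV (γ : ℝ) : ℝ :=
  (γ * (2 + γ) / (1 + γ) ^ 2) * (Real.logb 2 (Real.exp 1)) ^ 2

/-- The Laplace exponent `g(γ) = (C(γ) - R_c)² / (2 V(γ))`. -/
noncomputable def laplaceG (Rc γ : ℝ) : ℝ := (shannonC γ - Rc) ^ 2 / (2 * dispersionV γ)

open Topology in
theorem laplace_aux (u w : ℝ → ℝ) (a : ℝ) (hu : AnalyticAt ℝ u a) (hw : AnalyticAt ℝ w a)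
    (hu0 : u a = 0) (hu1 : deriv u a ≠ 0) (hw0 : w a ≠ 0) :
    Tendsto (fun x : ℝ => (deriv (fun y => u y ^ 2 * w y) x) ^ 2 /
      (2 * deriv (deriv (fun y => u y ^ 2 * w y)) x * (u x ^ 2 * w x))) (𝓝[≠] a) (𝓝 1) := by
  set h : ℝ → ℝ := fun x => 2 * deriv u x * w x + u x * deriv w x with hh
  have hha : AnalyticAt ℝ h a :=
    ((analyticAt_const.mul hu.deriv).mul hw).add (hu.mul hw.deriv)
  have e1 : deriv (fun y => u y ^ 2 * w y) =ᶠ[𝓝 a] fun x => u x * h x := by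
    filter_upwards [hu.eventually_analyticAt, hw.eventually_analyticAt] with x h1 h2
    have := ((h1.differentiableAt.hasDerivAt.pow 2).mul h2.differentiableAt.hasDerivAt).deriv
    refine Eq.trans this ?_
    simp [hh]
    ring
  have e2 : deriv (deriv (fun y => u y ^ 2 * w y)) =ᶠ[𝓝 a]
      fun x => deriv u x * h x + u x * deriv h x := by
    filter_upwards [e1.deriv, hu.eventually_analyticAt, hha.eventually_analyticAt] with x h0 h1 h2
    rw [h0]
    exact (h1.differentiableAt.hasDerivAt.mul h2.differentiableAt.hasDerivAt).deriv
  have hne : ∀ᶠ x in 𝓝[≠] a, u x ≠ 0 := by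
    have := hu.differentiableAt.hasDerivAt.eventually_ne hu1 (c := 0)
    exact this
  have key : Tendsto (fun x => h x ^ 2 /
      (2 * (deriv u x * h x + u x * deriv h x) * w x)) (𝓝 a) (𝓝 1) := by
    have hc : ContinuousAt (fun x => h x ^ 2 /
      (2 * (deriv u x * h x + u x * deriv h x) * w x)) a := by
      have := hha.continuousAt
      have := hha.deriv.continuousAt
      have := hu.continuousAt
      have := hu.deriv.continuousAt
      have := hw.continuousAt
      refine ContinuousAt.div (by fun_prop) (by fun_prop) ?_
      simp [hh, hu0, hu1, hw0]
    have := hc.tendsto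
    convert this using 2
    simp only [hh, hu0]
    field_simp
    ring
  refine (key.mono_left nhdsWithin_le_nhds).congr' ?_
  filter_upwards [hne, e1.filter_mono nhdsWithin_le_nhds, e2.filter_mono nhdsWithin_le_nhds]
    with x h0 h1 h2
  rw [h1, h2]
  rw [show (u x * h x) ^ 2 = u x ^ 2 * h x ^ 2 by ring,
    show 2 * (deriv u x * h x + u x * deriv h x) * (u x ^ 2 * w x) =
      u x ^ 2 * (2 * (deriv u x * h x + u x * deriv h x) * w x) by ring,
    mul_div_mul_left _ _ (pow_ne_zero 2 h0)]

/-- **Laplace-method ratio at the capacity-achieving SNR.** For fixed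
`R_c > 0` and `γ* = 2^{R_c} - 1`, the ratio `g'(γ)² / (2 g''(γ) g(γ))` tends to `1` as
`γ → γ*` within `(0, ∞) \ {γ*}`. -/
theorem laplace_ratio_tendsto_one (Rc : ℝ) (hRc : 0 < Rc) :
    Tendsto
      (fun γ : ℝ =>
        (deriv (laplaceG Rc) γ) ^ 2 / (2 * deriv (deriv (laplaceG Rc)) γ * laplaceG Rc γ))
      (nhdsWithin ((2 : ℝ) ^ Rc - 1) (Set.Ioi (0 : ℝ) \ {(2 : ℝ) ^ Rc - 1}))
      (nhds 1) := by
  have hpos : (0 : ℝ) < 2 ^ Rc := by positivity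
  have h1 : (1 : ℝ) < 2 ^ Rc := Real.one_lt_rpow (by norm_num) hRc
  have hl : Real.log 2 ≠ 0 := (Real.log_pos (by norm_num)).ne'
  set a : ℝ := (2 : ℝ) ^ Rc - 1 with ha
  have ha0 : 0 < a := by linarith
  have hg : laplaceG Rc = fun y => (Real.log (1 + y) / Real.log 2 - Rc) ^ 2 *
      (2 * dispersionV y)⁻¹ := by
    funext y
    simp [laplaceG, shannonC, Real.logb, div_eq_mul_inv]
  have hlog : AnalyticAt ℝ (fun y : ℝ => Real.log (1 + y)) a :=
    (analyticAt_const.add analyticAt_id).log (by simp; linarith)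
  have hV : 2 * dispersionV a ≠ 0 := by
    have : Real.logb 2 (Real.exp 1) ≠ 0 := by simp [Real.logb, hl]
    unfold dispersionV
    positivity
  have hVa : AnalyticAt ℝ dispersionV a := by
    unfold dispersionV
    refine AnalyticAt.mul (AnalyticAt.div (by fun_prop) (by fun_prop) (by positivity))
      analyticAt_const
  rw [hg]
  refine Tendsto.mono_left (laplace_aux (fun y => Real.log (1 + y) / Real.log 2 - Rc)
    (fun y => (2 * dispersionV y)⁻¹) a ?_ ?_ ?_ ?_ ?_) (nhdsWithin_mono _ fun x hx => hx.2)
  · exact (hlog.div analyticAt_const hl).sub analyticAt_const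
  · exact (analyticAt_const.mul hVa).inv hV
  · simp only [ha, add_sub_cancel]
    rw [Real.log_rpow (by norm_num)]
    field_simp
    ring
  · have hd : HasDerivAt (fun y : ℝ => Real.log (1 + y) / Real.log 2 - Rc)
        (1 / (1 + a) / Real.log 2) a :=
      ((((hasDerivAt_id a).const_add 1).log (by simp; linarith)).div_const _).sub_const _
    rw [hd.deriv]
    have : 1 + a ≠ 0 := by linarith
    simp [hl, this]
  · exact inv_ne_zero hV
end

section
/- (Lemma 4, log-concavity of the average packet success probability) Let L ≥ 1 be an integer and γ₀ > 0. Then the average packet success probability R_c ↦ 1 − ε̄(R_c) = Γ(L, (2^{R_c} − 1)/γ₀)/Γ(L) is log-concave on (0, ∞); that is, the function R_c ↦ ln Γ(L, (2^{R_c} − 1)/γ₀) is concave on (0, ∞). -/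
/-- Upper incomplete gamma function at integer parameter `L`:
`Γ(L, x) = ∫_x^∞ t^{L-1} e^{-t} dt`. -/
noncomputable def upperGamma (L : ℕ) (x : ℝ) : ℝ :=
  ∫ t in Set.Ioi x, t ^ (L - 1) * Real.exp (-t)

noncomputable def auxP : ℕ → ℝ → ℝ
  | 0, _ => 1
  | n + 1, x => x ^ (n + 1) + (n + 1) * auxP n x

noncomputable def auxD : ℕ → ℝ → ℝ
  | 0, _ => 0
  | n + 1, x => (n + 1) * x ^ n + (n + 1) * auxD n x

theorem auxP_pos (n : ℕ) (x : ℝ) (hx : 0 < x) : 0 < auxP n x := by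
  induction n with
  | zero => simp [auxP]
  | succ n ih => simp only [auxP]; positivity

theorem auxP_deriv (n : ℕ) (x : ℝ) : HasDerivAt (auxP n) (auxD n x) x := by
  induction n with
  | zero => exact hasDerivAt_const x (1 : ℝ)
  | succ n ih =>
    have h := (hasDerivAt_pow (n + 1) x).add (ih.const_mul ((n : ℝ) + 1))
    simp only [Nat.add_sub_cancel, Nat.cast_add, Nat.cast_one] at h
    exact h

theorem auxP_sub (n : ℕ) (x : ℝ) : auxP n x - auxD n x = x ^ n := by
  induction n with
  | zero => simp [auxP, auxD]
  | succ n ih =>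
    simp only [auxP, auxD]
    linear_combination ((n : ℝ) + 1) * ih

theorem auxP_tendsto (n : ℕ) :
    Filter.Tendsto (fun x => auxP n x * Real.exp (-x)) Filter.atTop (nhds 0) := by
  induction n with
  | zero => simpa [auxP] using Real.tendsto_pow_mul_exp_neg_atTop_nhds_zero 0
  | succ n ih =>
    have h := (Real.tendsto_pow_mul_exp_neg_atTop_nhds_zero (n + 1)).add
      (ih.const_mul ((n : ℝ) + 1))
    simp only [mul_zero, add_zero] at h
    refine h.congr fun x => ?_
    simp only [auxP]; ring

theorem auxP_ineq (n : ℕ) (x y : ℝ) (hx : 0 < x) (hxy : x ≤ y) :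
    x ^ n * auxP n y ≤ y ^ n * auxP n x := by
  induction n with
  | zero => simp [auxP]
  | succ n ih =>
    have hy : 0 < y := hx.trans_le hxy
    have h1 : x * (x ^ n * auxP n y) ≤ y * (y ^ n * auxP n x) :=
      mul_le_mul hxy ih (mul_nonneg (by positivity) (auxP_pos n y hy).le) hy.le
    have h2 := mul_le_mul_of_nonneg_left h1 (by positivity : (0 : ℝ) ≤ (n : ℝ) + 1)
    simp only [auxP]
    rw [pow_succ, pow_succ]
    nlinarith [h2]

theorem upperGamma_eq (n : ℕ) (x : ℝ) (hx : 0 < x) :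
    upperGamma (n + 1) x = auxP n x * Real.exp (-x) := by
  have hd : ∀ t : ℝ, HasDerivAt (fun t => -(auxP n t * Real.exp (-t)))
      (t ^ n * Real.exp (-t)) t := by
    intro t
    have h := ((auxP_deriv n t).mul ((hasDerivAt_neg t).exp)).neg
    refine h.congr_deriv ?_
    rw [← auxP_sub]; ring
  have h := MeasureTheory.integral_Ioi_of_hasDerivAt_of_nonneg' (a := x) (l := 0)
    (fun t _ => hd t)
    (fun t ht => mul_nonneg (pow_nonneg (hx.le.trans (le_of_lt ht)) n) (Real.exp_pos _).le)
    (by simpa using (auxP_tendsto n).neg)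
  simp only [upperGamma, Nat.add_sub_cancel]
  rw [h]; ring


/-- **Lemma 4, log-concavity of the average packet success probability.**
For an integer `L ≥ 1` and `γ₀ > 0`, the average packet success probability
`R_c ↦ Γ(L, (2^{R_c} - 1)/γ₀)/Γ(L)` is log-concave on `(0, ∞)`; that is,
`R_c ↦ ln Γ(L, (2^{R_c} - 1)/γ₀)` is concave on `(0, ∞)`. -/
theorem avgPacketSuccess_logConcave (L : ℕ) (hL : 1 ≤ L) (γ₀ : ℝ) (hγ₀ : 0 < γ₀) :
    ConcaveOn ℝ (Set.Ioi 0)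
      (fun Rc : ℝ => Real.log (upperGamma L (((2 : ℝ) ^ Rc - 1) / γ₀))) := by
  obtain ⟨n, rfl⟩ : ∃ n, L = n + 1 := ⟨L - 1, by omega⟩
  have hl : 0 < Real.log 2 := Real.log_pos (by norm_num)
  have hpos : ∀ R : ℝ, 0 < R → 0 < ((2 : ℝ) ^ R - 1) / γ₀ := fun R hR =>
    div_pos (sub_pos.2 (Real.one_lt_rpow (by norm_num) hR)) hγ₀
  have hder : ∀ R : ℝ, 0 < R → HasDerivAt
      (fun R : ℝ => Real.log (auxP n (((2 : ℝ) ^ R - 1) / γ₀)) - ((2 : ℝ) ^ R - 1) / γ₀)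
      (-((((2 : ℝ) ^ R - 1) / γ₀) ^ n / auxP n (((2 : ℝ) ^ R - 1) / γ₀)
        * ((2 : ℝ) ^ R * Real.log 2 / γ₀))) R := by
    intro R hR
    have hp := auxP_pos n _ (hpos R hR)
    have hx : HasDerivAt (fun R : ℝ => ((2 : ℝ) ^ R - 1) / γ₀)
        ((2 : ℝ) ^ R * Real.log 2 / γ₀) R := by
      have := (((hasDerivAt_id R).const_rpow (a := 2) (by norm_num)).sub_const 1).div_const γ₀
      refine this.congr_deriv ?_
      simp only [id]; ring
    have h1 := (((auxP_deriv n _).comp R hx).log hp.ne').sub hx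
    refine h1.congr_deriv ?_
    rw [← auxP_sub]
    simp only [Function.comp]
    field_simp
    ring
  have key : ConcaveOn ℝ (Set.Ioi 0)
      (fun R : ℝ => Real.log (auxP n (((2 : ℝ) ^ R - 1) / γ₀)) - ((2 : ℝ) ^ R - 1) / γ₀) := by
    refine AntitoneOn.concaveOn_of_deriv (convex_Ioi 0)
      (fun R hR => (hder R hR).continuousAt.continuousWithinAt) ?_ ?_
    · rw [interior_Ioi]
      exact fun R hR => (hder R hR).differentiableAt.differentiableWithinAt
    · rw [interior_Ioi]
      intro R hR S hS hRS
      rw [(hder R hR).deriv, (hder S hS).deriv]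
      have h2 : (2 : ℝ) ^ R ≤ (2 : ℝ) ^ S := Real.rpow_le_rpow_of_exponent_le (by norm_num) hRS
      have hxy : ((2 : ℝ) ^ R - 1) / γ₀ ≤ ((2 : ℝ) ^ S - 1) / γ₀ := by gcongr
      have hx := hpos R hR
      have hy := hpos S hS
      have hpx := auxP_pos n _ hx
      have hpy := auxP_pos n _ hy
      apply neg_le_neg
      apply mul_le_mul
      · rw [div_le_div_iff₀ hpx hpy]
        exact auxP_ineq n _ _ hx hxy
      · gcongr
      · positivity
      · exact div_nonneg (pow_nonneg hy.le n) hpy.le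
  refine key.congr fun R hR => ?_
  simp only
  rw [upperGamma_eq n _ (hpos R hR),
    Real.log_mul (auxP_pos n _ (hpos R hR)).ne' (Real.exp_pos _).ne', Real.log_exp]
  ring
end

section
/- (Derivative of the effective discriminant gain) Let U > 0, let N, d be positive integers, let μ₁, μ₂ ∈ ℝ^d, and let Σ be a symmetric positive-definite real d×d matrix. Then for every R_c > 0, the function D is differentiable at R_c with derivative D'(R_c) = ( N U² 2^{R} ln 2 / ( 3 d (2^{R} − 1)³ ) ) · ‖ (Σ + σ_q²(R_c) I)⁻¹ (μ₁ − μ₂) ‖₂², where R = N R_c / d. -/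
open Matrix

/-- Quantization-noise variance at coding rate `R_c`:
`σ_q²(R_c) = U² / (3 (2^{N R_c / d} - 1)²)`. -/
noncomputable def quantNoiseVar (U : ℝ) (N d : ℕ) (Rc : ℝ) : ℝ :=
  U ^ 2 / (3 * ((2 : ℝ) ^ ((N : ℝ) * Rc / (d : ℝ)) - 1) ^ 2)

/-- Effective discriminant gain at coding rate `R_c`:
`D(R_c) = (1/2)(μ₁-μ₂)ᵀ (Σ + σ_q²(R_c) I)⁻¹ (μ₁-μ₂)`. -/
noncomputable def effDiscGain (U : ℝ) (N d : ℕ) (μ₁ μ₂ : Fin d → ℝ)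
    (S : Matrix (Fin d) (Fin d) ℝ) (Rc : ℝ) : ℝ :=
  (1 / 2) * ((μ₁ - μ₂) ⬝ᵥ
    (S + quantNoiseVar U N d Rc • (1 : Matrix (Fin d) (Fin d) ℝ))⁻¹.mulVec (μ₁ - μ₂))

section helper
attribute [local instance] Matrix.linftyOpNormedRing Matrix.linftyOpNormedAlgebra

lemma aux_inv_deriv {d : ℕ} (v : Fin d → ℝ) (S : Matrix (Fin d) (Fin d) ℝ) (hsymm : S.IsSymm)
    (t : ℝ) (hu : IsUnit (S + t • (1 : Matrix (Fin d) (Fin d) ℝ))) :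
    HasDerivAt (fun s : ℝ => v ⬝ᵥ (S + s • (1 : Matrix (Fin d) (Fin d) ℝ))⁻¹.mulVec v)
      (- ∑ i, (((S + t • (1 : Matrix (Fin d) (Fin d) ℝ))⁻¹.mulVec v) i) ^ 2) t := by
  obtain ⟨u, hu⟩ := hu
  have h1 : HasDerivAt (fun s : ℝ => S + s • (1 : Matrix (Fin d) (Fin d) ℝ)) 1 t := by
    have := ((hasDerivAt_id t).smul_const (1 : Matrix (Fin d) (Fin d) ℝ)).const_add S
    exact this.congr_deriv (one_smul _ _)
  have h2 := hasFDerivAt_ringInverse (𝕜 := ℝ) u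
  rw [hu] at h2
  have h3 := h2.comp_hasDerivAt t h1
  let L : Matrix (Fin d) (Fin d) ℝ →ₗ[ℝ] ℝ :=
    { toFun := fun M => v ⬝ᵥ M.mulVec v
      map_add' := by intro A B; simp [Matrix.add_mulVec]
      map_smul' := by intro c A; simp [Matrix.smul_mulVec] }
  have h4 := (LinearMap.toContinuousLinearMap L).hasFDerivAt.comp_hasDerivAt t h3
  have hi : ((u⁻¹ : (Matrix (Fin d) (Fin d) ℝ)ˣ) : Matrix (Fin d) (Fin d) ℝ)
      = (S + t • (1 : Matrix (Fin d) (Fin d) ℝ))⁻¹ := by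
    rw [← hu, Matrix.coe_units_inv]
  have hs : ((S + t • (1 : Matrix (Fin d) (Fin d) ℝ))⁻¹)ᵀ
      = (S + t • (1 : Matrix (Fin d) (Fin d) ℝ))⁻¹ := by
    rw [Matrix.transpose_nonsing_inv]
    simp [hsymm.eq]
  have hf : (fun s : ℝ => v ⬝ᵥ (S + s • (1 : Matrix (Fin d) (Fin d) ℝ))⁻¹.mulVec v)
      = (LinearMap.toContinuousLinearMap L) ∘ Ring.inverse ∘
        (fun s : ℝ => S + s • (1 : Matrix (Fin d) (Fin d) ℝ)) := by
    funext s
    simp [L, Matrix.nonsing_inv_eq_ringInverse]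
  rw [hf]
  refine h4.congr_deriv ?_
  · simp only [_root_.neg_apply, ContinuousLinearMap.mulLeftRight_apply, hi]
    rw [mul_one]
    change v ⬝ᵥ (-((S + t • (1 : Matrix (Fin d) (Fin d) ℝ))⁻¹ *
      (S + t • (1 : Matrix (Fin d) (Fin d) ℝ))⁻¹)).mulVec v = _
    rw [Matrix.neg_mulVec, dotProduct_neg]
    rw [← Matrix.mulVec_mulVec, Matrix.dotProduct_mulVec, ← Matrix.mulVec_transpose, hs]
    simp [dotProduct, sq]

end helper

lemma aux_quant_deriv (U : ℝ) (N d : ℕ) (hN : 0 < N) (hd : 0 < d) (Rc : ℝ) (hRc : 0 < Rc) :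
    HasDerivAt (quantNoiseVar U N d)
      (-2 * ((N : ℝ) * U ^ 2 * (2 : ℝ) ^ ((N : ℝ) * Rc / (d : ℝ)) * Real.log 2
          / (3 * (d : ℝ) * ((2 : ℝ) ^ ((N : ℝ) * Rc / (d : ℝ)) - 1) ^ 3))) Rc := by
  have hN' : (0:ℝ) < N := by exact_mod_cast hN
  have hd' : (0:ℝ) < d := by exact_mod_cast hd
  have hp : (1:ℝ) < (2 : ℝ) ^ ((N : ℝ) * Rc / (d : ℝ)) :=
    Real.one_lt_rpow (by norm_num) (by positivity)
  have h0 : HasDerivAt (fun x : ℝ => (N : ℝ) * x / (d : ℝ)) ((N : ℝ) * 1 / d) Rc :=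
    ((hasDerivAt_id Rc).const_mul (N : ℝ)).div_const (d : ℝ)
  have h1 := h0.const_rpow (a := 2) (by norm_num)
  have h2 := ((h1.sub_const 1).pow 2).const_mul 3
  have hne : (2 : ℝ) ^ ((N : ℝ) * Rc / (d : ℝ)) - 1 ≠ 0 := by linarith
  have h3 := (hasDerivAt_const Rc (U ^ 2)).div h2 (by simpa using hne)
  refine h3.congr_deriv ?_
  simp only [Pi.pow_apply]
  generalize (2 : ℝ) ^ ((N : ℝ) * Rc / (d : ℝ)) = p at *
  field_simp
  ring

/-- **derivative of the effective discriminant gain.** For `U > 0`,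
positive integers `N, d`, `μ₁, μ₂ ∈ ℝ^d`, a symmetric positive-definite `Σ`, and
`R_c > 0`, the function `D` is differentiable at `R_c` with derivative
`D'(R_c) = (N U² 2^R ln 2 / (3 d (2^R - 1)³)) ‖(Σ + σ_q²(R_c) I)⁻¹ (μ₁-μ₂)‖₂²` where
`R = N R_c / d`. -/
theorem effDiscGain_hasDerivAt (U : ℝ) (hU : 0 < U) (N d : ℕ) (hN : 0 < N) (hd : 0 < d)
    (μ₁ μ₂ : Fin d → ℝ)
    (S : Matrix (Fin d) (Fin d) ℝ) (hsymm : S.IsSymm)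
    (hpd : ∀ x : Fin d → ℝ, x ≠ 0 → 0 < x ⬝ᵥ S.mulVec x)
    (Rc : ℝ) (hRc : 0 < Rc) :
    HasDerivAt (effDiscGain U N d μ₁ μ₂ S)
      ((N : ℝ) * U ^ 2 * (2 : ℝ) ^ ((N : ℝ) * Rc / (d : ℝ)) * Real.log 2
          / (3 * (d : ℝ) * ((2 : ℝ) ^ ((N : ℝ) * Rc / (d : ℝ)) - 1) ^ 3)
        * ∑ i,
            (((S + quantNoiseVar U N d Rc • (1 : Matrix (Fin d) (Fin d) ℝ))⁻¹.mulVec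
              (μ₁ - μ₂)) i) ^ 2) Rc := by
  have hu : IsUnit (S + quantNoiseVar U N d Rc • (1 : Matrix (Fin d) (Fin d) ℝ)) := by
    have hq : 0 ≤ quantNoiseVar U N d Rc := by unfold quantNoiseVar; positivity
    rw [← Matrix.mulVec_injective_iff_isUnit]
    intro x y hxy
    by_contra hne
    have h1 := hpd (x - y) (sub_ne_zero.mpr hne)
    have h2 : (S + quantNoiseVar U N d Rc • (1 : Matrix (Fin d) (Fin d) ℝ)).mulVec (x - y) = 0 := by
      rw [Matrix.mulVec_sub]; exact sub_eq_zero.mpr hxy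
    have h3 := congrArg (fun w => (x - y) ⬝ᵥ w) h2
    simp only [Matrix.add_mulVec, Matrix.smul_mulVec, Matrix.one_mulVec, dotProduct_add,
      dotProduct_smul, dotProduct_zero, smul_eq_mul] at h3
    have h4 : 0 ≤ (x - y) ⬝ᵥ (x - y) := by
      simp only [dotProduct]
      exact Finset.sum_nonneg fun i _ => mul_self_nonneg _
    have := mul_nonneg hq h4
    linarith
  have h := ((aux_inv_deriv (μ₁ - μ₂) S hsymm _ hu).comp Rc
    (aux_quant_deriv U N d hN hd Rc hRc)).const_mul (1 / 2)
  refine HasDerivAt.congr_deriv (f := effDiscGain U N d μ₁ μ₂ S) h ?_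
  ring
end
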